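/- Let F: A ⊗ (k⊗k⊗k) → Λ²(g) be the linear map which, under the identification of Λ²(g) with (Λ²(A)⊗S²(k)) ⊕ (A⊗Λ²(k)) ⊕ (I_A⊗Λ²(k)) via P, sends a ⊗ (x⊗y⊗w) to (a∧1 ⊗ [x,y]∨w) + a ⊗ ∂(x∧y∧w). Then, under the same identification, B₂(g) = Λ²(A) ⊗ k.S²(k) + T₀(A) ⊗ (k∨k') + im(F) + I_A ⊗ (k∧k'). Here k.S²(k) := span{ [x,y]∨w + y∨[x,w] : x,y,w ∈ k }, k' := [k,k], k∨k' := span{ x∨y : x ∈ k, y ∈ k' }, and k∧k' := span{ x∧y : x ∈ k, y ∈ k' }. -/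

import Mathlib

set_option linter.unusedSectionVars false
set_option synthInstance.maxHeartbeats 1000000
set_option maxHeartbeats 1000000
open scoped TensorProduct

namespace CurrentPaper

variable (K : Type*) [Field K] [CharZero K]

section Wedge

variable (V : Type*) [AddCommGroup V] [Module K V]

/-- `x ∧ y = (1/2)(x ⊗ y - y ⊗ x)` inside `V ⊗ V`. -/
noncomputable def wedge (x y : V) : V ⊗[K] V := (2 : K)⁻¹ • (x ⊗ₜ[K] y - y ⊗ₜ[K] x)

/-- `x ∨ y = (1/2)(x ⊗ y + y ⊗ x)` inside `V ⊗ V`. -/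
noncomputable def vee (x y : V) : V ⊗[K] V := (2 : K)⁻¹ • (x ⊗ₜ[K] y + y ⊗ₜ[K] x)

/-- `Λ²(V)` realized as the subspace of skew-symmetric tensors of `V ⊗ V`. -/
def lambda2 : Submodule K (V ⊗[K] V) := Submodule.span K {t | ∃ x y : V, t = wedge K V x y}

/-- `S²(V)` realized as the subspace of symmetric tensors of `V ⊗ V`. -/
def sym2 : Submodule K (V ⊗[K] V) := Submodule.span K {t | ∃ x y : V, t = vee K V x y}

variable {V}

lemma wedge_mem (x y : V) : wedge K V x y ∈ lambda2 K V := Submodule.subset_span ⟨x, y, rfl⟩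

lemma vee_mem (x y : V) : vee K V x y ∈ sym2 K V := Submodule.subset_span ⟨x, y, rfl⟩

end Wedge

section LieRelaxed

variable (L : Type*) [LieRing L] [Module K L]

/-- `∂(u ∧ v ∧ w) = ⁅u,v⁆ ∧ w + ⁅v,w⁆ ∧ u + ⁅w,u⁆ ∧ v`. -/
noncomputable def dd (u v w : L) : L ⊗[K] L :=
  wedge K L ⁅u, v⁆ w + wedge K L ⁅v, w⁆ u + wedge K L ⁅w, u⁆ v

/-- `B₂(L)`, the space of 2-boundaries, i.e. the image of `∂ : Λ³(L) → Λ²(L)`. -/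
def B2 : Submodule K (L ⊗[K] L) := Submodule.span K {t | ∃ u v w : L, t = dd K L u v w}

variable {L}

lemma dd_mem_lambda2 (u v w : L) : dd K L u v w ∈ lambda2 K L :=
  add_mem (add_mem (wedge_mem K _ _) (wedge_mem K _ _)) (wedge_mem K _ _)

lemma dd_mem_B2 (u v w : L) : dd K L u v w ∈ B2 K L := Submodule.subset_span ⟨u, v, w, rfl⟩

end LieRelaxed

section Lie

variable (L : Type*) [LieRing L] [LieAlgebra K L]

/-- The bracket `b : L ⊗ L → L`, `u ⊗ v ↦ ⁅u,v⁆`, as a linear map. -/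
noncomputable def bracketHom : L ⊗[K] L →ₗ[K] L :=
  TensorProduct.lift (LinearMap.mk₂ K (fun u v => ⁅u, v⁆) add_lie smul_lie lie_add lie_smul)

/-- `Z₂(L) = Λ²(L) ∩ ker b`, the space of 2-cycles. -/
noncomputable def Z2 : Submodule K (L ⊗[K] L) := lambda2 K L ⊓ LinearMap.ker (bracketHom K L)

/-- The derived algebra `L' = [L,L]`, as a subspace of `L`. -/
def derived : Submodule K L := Submodule.span K {m | ∃ u v : L, m = ⁅u, v⁆}

end Lie

section Alg

variable (A : Type*) [CommRing A] [Algebra K A]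

/-- `I_A ⊆ S²(A)`: the kernel of the multiplication map `S²(A) → A`. -/
noncomputable def ia : Submodule K (A ⊗[K] A) := sym2 K A ⊓ LinearMap.ker (LinearMap.mul' K A)

/-- `T(A) ⊆ Λ²(A)`: the span of the elements `ab ∧ c + bc ∧ a + ca ∧ b`. -/
def TA : Submodule K (A ⊗[K] A) :=
  Submodule.span K
    {t | ∃ a b c : A, t = wedge K A (a*b) c + wedge K A (b*c) a + wedge K A (c*a) b}

/-- `T₀(A) ⊆ Λ²(A)`: the span of the elements `ab ∧ c + bc ∧ a + ca ∧ b - abc ∧ 1`. -/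
def T0A : Submodule K (A ⊗[K] A) :=
  Submodule.span K
    {t | ∃ a b c : A,
      t = wedge K A (a*b) c + wedge K A (b*c) a + wedge K A (c*a) b - wedge K A (a*b*c) 1}

variable {A}

lemma TA_el_mem_lambda2 (a b c : A) :
    wedge K A (a*b) c + wedge K A (b*c) a + wedge K A (c*a) b ∈ lambda2 K A :=
  add_mem (add_mem (wedge_mem K _ _) (wedge_mem K _ _)) (wedge_mem K _ _)

lemma T0A_el_mem_lambda2 (a b c : A) :
    wedge K A (a*b) c + wedge K A (b*c) a + wedge K A (c*a) b - wedge K A (a*b*c) 1 ∈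
      lambda2 K A :=
  sub_mem (TA_el_mem_lambda2 K a b c) (wedge_mem K _ _)

lemma ia_el_mem (a b : A) : vee K A a b - vee K A (a * b) 1 ∈ ia K A := by
  refine Submodule.mem_inf.mpr ⟨sub_mem (vee_mem K a b) (vee_mem K _ _), ?_⟩
  simp only [LinearMap.mem_ker, map_sub, vee, map_smul, map_add, LinearMap.mul'_apply,
    mul_one, one_mul, mul_comm b a]
  simp

end Alg

section Current

variable (A : Type*) [CommRing A] [Algebra K A]
variable (k : Type*) [LieRing k] [LieAlgebra K k]

lemma g_smul_lie (c : K) (x y : A ⊗[K] k) : ⁅c • x, y⁆ = c • ⁅x, y⁆ := by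
  rw [← algebraMap_smul A c x, ← algebraMap_smul A c ⁅x, y⁆, smul_lie]

lemma g_lie_smul (c : K) (x y : A ⊗[K] k) : ⁅x, c • y⁆ = c • ⁅x, y⁆ := by
  rw [← algebraMap_smul A c y, ← algebraMap_smul A c ⁅x, y⁆, lie_smul]

/-- The bracket of the current algebra `g = A ⊗ k`, as a `K`-linear map `g ⊗ g → g`. -/
noncomputable def gBracket : (A ⊗[K] k) ⊗[K] (A ⊗[K] k) →ₗ[K] A ⊗[K] k :=
  TensorProduct.lift (LinearMap.mk₂ K (fun u v => ⁅u, v⁆) add_lie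
    (fun c x y => g_smul_lie K A k c x y) lie_add (fun c x y => g_lie_smul K A k c x y))

/-- `Z₂(g) = Λ²(g) ∩ ker b` for the current algebra `g = A ⊗ k`. -/
noncomputable def Z2g : Submodule K ((A ⊗[K] k) ⊗[K] (A ⊗[K] k)) :=
  lambda2 K (A ⊗[K] k) ⊓ LinearMap.ker (gBracket K A k)

/-- The first summand `Λ²(A) ⊗ S²(k)` of the decomposition of `Λ²(A ⊗ k)`. -/
abbrev M1 := (↥(lambda2 K A)) ⊗[K] (↥(sym2 K k))

/-- The second summand `A ⊗ Λ²(k)` of the decomposition of `Λ²(A ⊗ k)`. -/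
abbrev M2 := A ⊗[K] (↥(lambda2 K k))

/-- The third summand `I_A ⊗ Λ²(k)` of the decomposition of `Λ²(A ⊗ k)`. -/
abbrev M3 := (↥(ia K A)) ⊗[K] (↥(lambda2 K k))

/-- The target of the isomorphism `P = (p₁,p₂,p₃)`. -/
abbrev Wspace := M1 K A k × M2 K A k × M3 K A k

variable {A k}

/-- The property characterizing the linear isomorphism
`P = (p₁,p₂,p₃) : Λ²(A ⊗ k) ≅ (Λ²(A) ⊗ S²(k)) ⊕ (A ⊗ Λ²(k)) ⊕ (I_A ⊗ Λ²(k))`: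
`p₁(ax ∧ by) = a ∧ b ⊗ x ∨ y`, `p₂(ax ∧ by) = ab ⊗ x ∧ y`,
`p₃(ax ∧ by) = (a ∨ b - ab ∨ 1) ⊗ x ∧ y`. -/
def IsDecomposition (P : ↥(lambda2 K (A ⊗[K] k)) ≃ₗ[K] Wspace K A k) : Prop :=
  ∀ (a b : A) (x y : k),
    P ⟨wedge K (A ⊗[K] k) (a ⊗ₜ x) (b ⊗ₜ y), wedge_mem K _ _⟩ =
      ((⟨wedge K A a b, wedge_mem K a b⟩ ⊗ₜ[K] ⟨vee K k x y, vee_mem K x y⟩ : M1 K A k),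
       ((a * b) ⊗ₜ[K] ⟨wedge K k x y, wedge_mem K x y⟩ : M2 K A k),
       ((⟨vee K A a b - vee K A (a * b) 1, ia_el_mem K a b⟩ ⊗ₜ[K]
          ⟨wedge K k x y, wedge_mem K x y⟩ : M3 K A k)))

end Current

end CurrentPaper

namespace CurrentPaper

variable (K : Type*) [Field K] [CharZero K]
variable (A : Type*) [CommRing A] [Algebra K A]
variable (k : Type*) [LieRing k] [LieAlgebra K k]

/-- `k.S²(k) = span{ [x,y] ∨ w + y ∨ [x,w] } ⊆ S²(k)`. -/
noncomputable def kActS2 : Submodule K (k ⊗[K] k) :=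
  Submodule.span K {t | ∃ x y w : k, t = vee K k ⁅x, y⁆ w + vee K k y ⁅x, w⁆}

/-- `k ∨ k' = span{ x ∨ y : x ∈ k, y ∈ k' } ⊆ S²(k)`. -/
noncomputable def kVeeDer : Submodule K (k ⊗[K] k) :=
  Submodule.span K {t | ∃ x y : k, y ∈ derived K k ∧ t = vee K k x y}

/-- `k ∧ k' = span{ x ∧ y : x ∈ k, y ∈ k' } ⊆ Λ²(k)`. -/
noncomputable def kWedgeDer : Submodule K (k ⊗[K] k) :=
  Submodule.span K {t | ∃ x y : k, y ∈ derived K k ∧ t = wedge K k x y}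

/-- The subspace `Λ²(A) ⊗ k.S²(k)` of `Λ²(A) ⊗ S²(k)`. -/
noncomputable def sub1a : Submodule K (M1 K A k) :=
  Submodule.span K {t | ∃ (ω : ↥(lambda2 K A)) (s : ↥(sym2 K k)),
    (s : k ⊗[K] k) ∈ kActS2 K k ∧ t = ω ⊗ₜ[K] s}

/-- The subspace `T₀(A) ⊗ (k ∨ k')` of `Λ²(A) ⊗ S²(k)`. -/
noncomputable def sub1b : Submodule K (M1 K A k) :=
  Submodule.span K {t | ∃ (ω : ↥(lambda2 K A)) (s : ↥(sym2 K k)),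
    (ω : A ⊗[K] A) ∈ T0A K A ∧ (s : k ⊗[K] k) ∈ kVeeDer K k ∧ t = ω ⊗ₜ[K] s}

/-- The subspace `I_A ⊗ (k ∧ k')` of `I_A ⊗ Λ²(k)`. -/
noncomputable def sub3 : Submodule K (M3 K A k) :=
  Submodule.span K {t | ∃ (c : ↥(ia K A)) (s : ↥(lambda2 K k)),
    (s : k ⊗[K] k) ∈ kWedgeDer K k ∧ t = c ⊗ₜ[K] s}

/-- The image of the map `F : A ⊗ (k ⊗ k ⊗ k) → Λ²(g)`,
`a ⊗ (x ⊗ y ⊗ w) ↦ (a ∧ 1 ⊗ [x,y] ∨ w) + a ⊗ ∂(x ∧ y ∧ w)`,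
under the identification of `Λ²(g)` with the threefold direct sum via `P`. -/
noncomputable def imF : Submodule K (Wspace K A k) :=
  Submodule.span K {t | ∃ (a : A) (x y w : k),
    t = (((⟨wedge K A a 1, wedge_mem K a 1⟩ ⊗ₜ[K]
            ⟨vee K k ⁅x, y⁆ w, vee_mem K _ _⟩ : M1 K A k),
          (a ⊗ₜ[K] ⟨dd K k x y w, dd_mem_lambda2 K x y w⟩ : M2 K A k),
          (0 : M3 K A k)) : Wspace K A k)}

section WedgeVee

variable (V : Type*) [AddCommGroup V] [Module K V]

/-- The alternating product as a bilinear map. -/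
noncomputable def wedgeHom : V →ₗ[K] V →ₗ[K] V ⊗[K] V :=
  (2 : K)⁻¹ • (TensorProduct.mk K V V - (TensorProduct.mk K V V).flip)

/-- The symmetric product as a bilinear map. -/
noncomputable def veeHom : V →ₗ[K] V →ₗ[K] V ⊗[K] V :=
  (2 : K)⁻¹ • (TensorProduct.mk K V V + (TensorProduct.mk K V V).flip)

variable {V}

lemma wedgeHom_apply (x y : V) : wedgeHom K V x y = wedge K V x y := rfl

lemma veeHom_apply (x y : V) : veeHom K V x y = vee K V x y := rfl

lemma wedge_swap (x y : V) : wedge K V x y = -wedge K V y x := by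
  simp only [wedge, ← smul_neg, neg_sub]

lemma vee_comm (x y : V) : vee K V x y = vee K V y x := by
  simp only [vee, add_comm]

lemma vee_neg_left (x y : V) : vee K V (-x) y = -vee K V x y := by
  simp only [← veeHom_apply, map_neg, LinearMap.neg_apply]

end WedgeVee

section Span

variable {K}

/-- A bilinear map on two subspaces sends subspaces spanned by given sets into any subspace
containing the images of pairs of generators. -/
lemma bilin_mem_of_mem_span {V W M : Type*} [AddCommGroup V] [Module K V]
    [AddCommGroup W] [Module K W] [AddCommMonoid M] [Module K M]
    {p : Submodule K V} {q : Submodule K W} {S : Set V} {T : Set W}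
    (hS : S ⊆ p) (hT : T ⊆ q) {N : Submodule K M} (f : p →ₗ[K] q →ₗ[K] M)
    (h : ∀ s (hs : s ∈ S) t (ht : t ∈ T), f ⟨s, hS hs⟩ ⟨t, hT ht⟩ ∈ N)
    {v : p} (hv : (v : V) ∈ Submodule.span K S) {w : q} (hw : (w : W) ∈ Submodule.span K T) :
    f v w ∈ N := by
  have key : ∀ t (ht : t ∈ T), f v ⟨t, hT ht⟩ ∈ N := by
    intro t ht
    have hle : Submodule.span K S ≤ (N.comap (f.flip ⟨t, hT ht⟩)).map p.subtype :=
      Submodule.span_le.2 fun s hs => ⟨⟨s, hS hs⟩, h s hs t ht, rfl⟩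
    obtain ⟨v', hv', e⟩ := hle hv
    obtain rfl : v' = v := Subtype.ext e
    exact hv'
  have hle : Submodule.span K T ≤ (N.comap (f v)).map q.subtype :=
    Submodule.span_le.2 fun t ht => ⟨⟨t, hT ht⟩, key t ht, rfl⟩
  obtain ⟨w', hw', e⟩ := hle hw
  obtain rfl : w' = w := Subtype.ext e
  exact hw'

lemma mem_of_add_mem {M : Type*} [AddCommMonoid M] [Module K M] {N : Submodule K M} {u v : M}
    (h : u + v ∈ N) (hv : v ∈ N) : u ∈ N := by
  have e : u + v + (-1 : K) • v = u := by
    nth_rewrite 1 [← one_smul K v]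
    rw [add_assoc, ← add_smul, add_neg_cancel, zero_smul, add_zero]
  rw [← e]
  exact add_mem h (N.smul_mem _ hv)

end Span

section Generators

lemma ia_le_span :
    ia K A ≤ Submodule.span K {t | ∃ a b : A, t = vee K A a b - vee K A (a * b) 1} := by
  rintro t ⟨ht, hmul⟩
  let φ : A ⊗[K] A →ₗ[K] A ⊗[K] A :=
    LinearMap.id - ((veeHom K A).flip 1) ∘ₗ LinearMap.mul' K A
  have hφ : ∀ a b : A, φ (vee K A a b) = vee K A a b - vee K A (a * b) 1 := by
    intro a b
    have : LinearMap.mul' K A (vee K A a b) = a * b := by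
      simp only [vee, map_smul, map_add, LinearMap.mul'_apply, mul_comm b a, ← two_smul K (a * b)]
      rw [smul_smul, inv_mul_cancel₀ two_ne_zero, one_smul]
    simp [φ, this, veeHom_apply]
  have hle : sym2 K A ≤ (Submodule.span K
      {t | ∃ a b : A, t = vee K A a b - vee K A (a * b) 1}).comap φ := by
    refine Submodule.span_le.2 ?_
    rintro _ ⟨a, b, rfl⟩
    exact Submodule.subset_span ⟨a, b, hφ a b⟩
  have h0 : φ t = t := by
    have : LinearMap.mul' K A t = 0 := hmul
    simp [φ, this]
  simpa [h0] using hle ht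

lemma kVeeDer_le_span :
    kVeeDer K k ≤ Submodule.span K {t | ∃ x y w : k, t = vee K k ⁅x, y⁆ w} := by
  refine Submodule.span_le.2 ?_
  rintro _ ⟨w, z, hz, rfl⟩
  have hle : derived K k ≤ (Submodule.span K
      {t | ∃ x y w : k, t = vee K k ⁅x, y⁆ w}).comap (veeHom K k w) := by
    refine Submodule.span_le.2 ?_
    rintro _ ⟨x, y, rfl⟩
    exact Submodule.subset_span ⟨x, y, w, vee_comm K _ _⟩
  exact hle hz

lemma kWedgeDer_le_span :
    kWedgeDer K k ≤ Submodule.span K {t | ∃ x y w : k, t = wedge K k ⁅x, y⁆ w} := by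
  refine Submodule.span_le.2 ?_
  rintro _ ⟨w, z, hz, rfl⟩
  have hle : derived K k ≤ (Submodule.span K
      {t | ∃ x y w : k, t = wedge K k ⁅x, y⁆ w}).comap (wedgeHom K k w) := by
    refine Submodule.span_le.2 ?_
    rintro _ ⟨x, y, rfl⟩
    change wedge K k w ⁅x, y⁆ ∈ Submodule.span K _
    rw [wedge_swap]
    exact neg_mem (Submodule.subset_span ⟨x, y, w, rfl⟩)
  exact hle hz

variable {A k}

lemma vee_lie_mem_kVeeDer (x y w : k) : vee K k ⁅x, y⁆ w ∈ kVeeDer K k :=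
  Submodule.subset_span ⟨w, ⁅x, y⁆, Submodule.subset_span ⟨x, y, rfl⟩, vee_comm K _ _⟩

lemma wedge_lie_mem_kWedgeDer (x y w : k) : wedge K k ⁅x, y⁆ w ∈ kWedgeDer K k := by
  rw [wedge_swap]
  exact neg_mem (Submodule.subset_span ⟨w, ⁅x, y⁆, Submodule.subset_span ⟨x, y, rfl⟩, rfl⟩)

lemma vee_lie_sub_rotate_mem_kActS2 (x y w : k) :
    vee K k ⁅w, x⁆ y - vee K k ⁅x, y⁆ w ∈ kActS2 K k := by
  have h : vee K k ⁅x, y⁆ w + vee K k y ⁅x, w⁆ ∈ kActS2 K k := Submodule.subset_span ⟨x, y, w, rfl⟩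
  rw [vee_comm K y, ← lie_skew x w, vee_neg_left] at h
  convert neg_mem h using 1
  abel

/-- `a ∧ b` as an element of `Λ²(V)`. -/
noncomputable def lambda2Mk {V : Type*} [AddCommGroup V] [Module K V] (x y : V) :
    lambda2 K V := ⟨wedge K V x y, wedge_mem K x y⟩

/-- `x ∨ y` as an element of `S²(V)`. -/
noncomputable def sym2Mk {V : Type*} [AddCommGroup V] [Module K V] (x y : V) :
    sym2 K V := ⟨vee K V x y, vee_mem K x y⟩

/-- `a ∨ b - ab ∨ 1` as an element of `I_A`. -/
noncomputable def iaMk (a b : A) : ia K A :=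
  ⟨vee K A a b - vee K A (a * b) 1, ia_el_mem K a b⟩

/-- `∂(u ∧ v ∧ w)` as an element of `Λ²(L)`. -/
noncomputable def ddMk {L : Type*} [LieRing L] [Module K L] (u v w : L) : lambda2 K L :=
  ⟨dd K L u v w, dd_mem_lambda2 K u v w⟩

/-- `ab ∧ c + bc ∧ a + ca ∧ b - abc ∧ 1` as an element of `Λ²(A)`. -/
noncomputable def T0Mk (a b c : A) : lambda2 K A :=
  lambda2Mk K (a * b) c + lambda2Mk K (b * c) a + lambda2Mk K (c * a) b - lambda2Mk K (a * b * c) 1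

lemma T0Mk_mem (a b c : A) : (T0Mk K a b c : A ⊗[K] A) ∈ T0A K A :=
  Submodule.subset_span ⟨a, b, c, rfl⟩

lemma lambda2Mk_swap {V : Type*} [AddCommGroup V] [Module K V] (x y : V) :
    lambda2Mk K x y = -lambda2Mk K y x := Subtype.ext (wedge_swap K x y)

lemma iaMk_comm (a b : A) : iaMk K a b = iaMk K b a :=
  Subtype.ext (by simp only [iaMk, vee_comm K a b, mul_comm a b])

lemma iaMk_one (a : A) : iaMk K a 1 = 0 := Subtype.ext (by simp [iaMk])

lemma ddMk_eq {L : Type*} [LieRing L] [Module K L] (u v w : L) :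
    ddMk K u v w = lambda2Mk K ⁅u, v⁆ w + lambda2Mk K ⁅v, w⁆ u + lambda2Mk K ⁅w, u⁆ v := rfl

/-- The image of `∂(ax ∧ by ∧ cw)` under the decomposition `P`. -/
noncomputable def ddComponents (a b c : A) (x y w : k) : Wspace K A k :=
  (lambda2Mk K (a * b) c ⊗ₜ[K] sym2Mk K ⁅x, y⁆ w + lambda2Mk K (b * c) a ⊗ₜ[K] sym2Mk K ⁅y, w⁆ x
      + lambda2Mk K (c * a) b ⊗ₜ[K] sym2Mk K ⁅w, x⁆ y,
    (a * b * c) ⊗ₜ[K] ddMk K x y w,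
    iaMk K (a * b) c ⊗ₜ[K] lambda2Mk K ⁅x, y⁆ w + iaMk K (b * c) a ⊗ₜ[K] lambda2Mk K ⁅y, w⁆ x
      + iaMk K (c * a) b ⊗ₜ[K] lambda2Mk K ⁅w, x⁆ y)

lemma decomposition_ddMk {P : ↥(lambda2 K (A ⊗[K] k)) ≃ₗ[K] Wspace K A k}
    (hP : IsDecomposition K P) (a b c : A) (x y w : k) :
    P (ddMk K (a ⊗ₜ[K] x) (b ⊗ₜ[K] y) (c ⊗ₜ[K] w)) = ddComponents K a b c x y w := by
  have hP' : ∀ (a b : A) (x y : k), P (lambda2Mk K (a ⊗ₜ[K] x) (b ⊗ₜ[K] y)) =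
      (lambda2Mk K a b ⊗ₜ[K] sym2Mk K x y, (a * b) ⊗ₜ[K] lambda2Mk K x y,
        iaMk K a b ⊗ₜ[K] lambda2Mk K x y) := hP
  simp only [ddMk_eq, LieAlgebra.ExtendScalars.bracket_tmul, map_add, hP', ddComponents,
    Prod.mk_add_mk, TensorProduct.tmul_add]
  rw [show b * c * a = a * b * c by ring, show c * a * b = a * b * c by ring]

/-- `F(a ⊗ (x ⊗ y ⊗ w))`. -/
noncomputable def FComponents (a : A) (x y w : k) : Wspace K A k :=
  (lambda2Mk K a 1 ⊗ₜ[K] sym2Mk K ⁅x, y⁆ w, a ⊗ₜ[K] ddMk K x y w, 0)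

/-- Reduction of `∂(ax ∧ by ∧ cw)` to standard elements of the four summands of `B₂(g)`. -/
lemma ddComponents_eq (a b c : A) (x y w : k) :
    ddComponents K a b c x y w =
      (lambda2Mk K (b * c) a ⊗ₜ[K] (sym2Mk K ⁅y, w⁆ x - sym2Mk K ⁅x, y⁆ w)
        + lambda2Mk K (c * a) b ⊗ₜ[K] (sym2Mk K ⁅w, x⁆ y - sym2Mk K ⁅x, y⁆ w), 0, 0)
      + (T0Mk K a b c ⊗ₜ[K] sym2Mk K ⁅x, y⁆ w, 0, 0)
      + FComponents K (a * b * c) x y w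
      + (0, 0, iaMk K (a * b) c ⊗ₜ[K] lambda2Mk K ⁅x, y⁆ w
        + iaMk K (b * c) a ⊗ₜ[K] lambda2Mk K ⁅y, w⁆ x
        + iaMk K (c * a) b ⊗ₜ[K] lambda2Mk K ⁅w, x⁆ y) := by
  simp only [ddComponents, FComponents, T0Mk, Prod.mk_add_mk, TensorProduct.tmul_sub,
    TensorProduct.add_tmul, TensorProduct.sub_tmul, zero_add, add_zero]
  congr 1
  abel

/-- The multilinear extension of a membership statement from pure tensors to all of `g`. -/
lemma ddMk_mem {N : Submodule K (lambda2 K (A ⊗[K] k))}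
    (h : ∀ (a b c : A) (x y w : k), ddMk K (a ⊗ₜ[K] x) (b ⊗ₜ[K] y) (c ⊗ₜ[K] w) ∈ N)
    (u v w : A ⊗[K] k) : ddMk K u v w ∈ N := by
  have z : lambda2Mk K (0 : A ⊗[K] k) = 0 := by
    ext x; simp [lambda2Mk, wedge]
  have z' (x : A ⊗[K] k) : lambda2Mk K x 0 = 0 := by
    ext; simp [lambda2Mk, wedge]
  have l (x y t : A ⊗[K] k) : lambda2Mk K (x + y) t = lambda2Mk K x t + lambda2Mk K y t :=
    Subtype.ext (by simp [lambda2Mk, ← wedgeHom_apply])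
  have r (x y t : A ⊗[K] k) : lambda2Mk K t (x + y) = lambda2Mk K t x + lambda2Mk K t y :=
    Subtype.ext (by simp [lambda2Mk, ← wedgeHom_apply])
  induction u with
  | zero => simp [ddMk_eq, z, z']
  | add u u' hu hu' =>
    convert add_mem hu hu' using 1
    simp only [ddMk_eq, add_lie, lie_add, l, r]; abel
  | tmul a x =>
    induction v with
    | zero => simp [ddMk_eq, z, z']
    | add u u' hu hu' =>
      convert add_mem hu hu' using 1
      simp only [ddMk_eq, add_lie, lie_add, l, r]; abel
    | tmul b y =>
      induction w with
      | zero => simp [ddMk_eq, z, z']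
      | add u u' hu hu' =>
        convert add_mem hu hu' using 1
        simp only [ddMk_eq, add_lie, lie_add, l, r]; abel
      | tmul c w => exact h a b c x y w

variable {K}

lemma cyclic_correction_mem {N : Submodule K (Wspace K A k)}
    (h : ∀ (ω : lambda2 K A) (s : sym2 K k), (s : k ⊗[K] k) ∈ kActS2 K k →
      ((ω ⊗ₜ[K] s, 0, 0) : Wspace K A k) ∈ N) (ω ω' : lambda2 K A) (x y w : k) :
    ((ω ⊗ₜ[K] (sym2Mk K ⁅y, w⁆ x - sym2Mk K ⁅x, y⁆ w)
      + ω' ⊗ₜ[K] (sym2Mk K ⁅w, x⁆ y - sym2Mk K ⁅x, y⁆ w), 0, 0) : Wspace K A k) ∈ N := by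
  have h₁ : vee K k ⁅y, w⁆ x - vee K k ⁅x, y⁆ w ∈ kActS2 K k := by
    simpa using neg_mem (vee_lie_sub_rotate_mem_kActS2 K y w x)
  simpa using add_mem (h ω (sym2Mk K ⁅y, w⁆ x - sym2Mk K ⁅x, y⁆ w) h₁)
    (h ω' (sym2Mk K ⁅w, x⁆ y - sym2Mk K ⁅x, y⁆ w) (vee_lie_sub_rotate_mem_kActS2 K x y w))

/-- If the four standard families lie in a subspace, so do the images of all pure boundaries. -/
lemma ddComponents_mem {N : Submodule K (Wspace K A k)}
    (h₁ : ∀ (ω : lambda2 K A) (s : sym2 K k), (s : k ⊗[K] k) ∈ kActS2 K k →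
      ((ω ⊗ₜ[K] s, 0, 0) : Wspace K A k) ∈ N)
    (h₂ : ∀ (a b c : A) (x y w : k),
      ((T0Mk K a b c ⊗ₜ[K] sym2Mk K ⁅x, y⁆ w, 0, 0) : Wspace K A k) ∈ N)
    (h₃ : ∀ (a : A) (x y w : k), FComponents K a x y w ∈ N)
    (h₄ : ∀ (a b : A) (x y w : k),
      ((0, 0, iaMk K a b ⊗ₜ[K] lambda2Mk K ⁅x, y⁆ w) : Wspace K A k) ∈ N)
    (a b c : A) (x y w : k) : ddComponents K a b c x y w ∈ N := by
  rw [ddComponents_eq]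
  refine add_mem (add_mem (add_mem (cyclic_correction_mem h₁ _ _ x y w) (h₂ a b c x y w))
    (h₃ _ x y w)) ?_
  simpa using add_mem (add_mem (h₄ (a * b) c x y w) (h₄ (b * c) a y w x)) (h₄ (c * a) b w x y)

section Boundaries

variable {N : Submodule K (Wspace K A k)}
  (hN : ∀ (a b c : A) (x y w : k), ddComponents K a b c x y w ∈ N)

include hN

lemma tmul_kActS2_mem (ω : lambda2 K A) (s : sym2 K k) (hs : (s : k ⊗[K] k) ∈ kActS2 K k) :
    ((ω ⊗ₜ[K] s, 0, 0) : Wspace K A k) ∈ N := by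
  have hT : {t | ∃ x y w : k, t = vee K k ⁅x, y⁆ w + vee K k y ⁅x, w⁆} ⊆
      (sym2 K k : Set (k ⊗[K] k)) := by
    rintro _ ⟨x, y, w, rfl⟩
    exact add_mem (vee_mem K _ _) (vee_mem K _ _)
  refine bilin_mem_of_mem_span (Submodule.subset_span) hT
    ((TensorProduct.mk K (lambda2 K A) (sym2 K k)).compr₂
      (LinearMap.inl K (M1 K A k) (M2 K A k × M3 K A k))) ?_ ω.2 hs
  rintro _ ⟨a, b, rfl⟩ _ ⟨x, y, w, rfl⟩
  change ((lambda2Mk K a b ⊗ₜ[K] (sym2Mk K ⁅x, y⁆ w + sym2Mk K y ⁅x, w⁆), 0, 0) :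
    Wspace K A k) ∈ N
  have hs : sym2Mk K y ⁅x, w⁆ = -sym2Mk K ⁅w, x⁆ y := Subtype.ext <| by
    change vee K k y ⁅x, w⁆ = -vee K k ⁅w, x⁆ y
    rw [vee_comm, ← lie_skew, vee_neg_left]
  rw [← N.smul_mem_iff (two_ne_zero (α := K))]
  refine mem_of_add_mem (v := ddComponents K 1 b a x y w) ?_ (hN 1 b a x y w)
  convert hN 1 a b x y w using 1
  simp only [ddComponents, one_mul, mul_one, mul_comm b a, lambda2Mk_swap K b a,
    iaMk_comm K b a, two_smul, hs]
  refine Prod.ext ?_ (Prod.ext ?_ ?_)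
  · simp only [Prod.mk_add_mk, TensorProduct.tmul_add, TensorProduct.tmul_neg,
      TensorProduct.neg_tmul]
    abel
  · simp
  · simp

lemma FComponents_mem (a : A) (x y w : k) : FComponents K a x y w ∈ N := by
  have hT : T0Mk K a 1 1 = 0 := by
    simp only [T0Mk, mul_one, one_mul, lambda2Mk_swap K 1 a]
    abel
  have h := hN a 1 1 x y w
  rw [ddComponents_eq, hT, add_assoc, add_assoc, add_comm] at h
  have h' := mem_of_add_mem h (cyclic_correction_mem (tmul_kActS2_mem hN) _ _ x y w)
  simpa [FComponents, iaMk_comm K 1 a, iaMk_one] using h'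

lemma ia_tmul_add_mem (a b : A) (x y w : k) :
    ((0, 0, iaMk K a b ⊗ₜ[K] (lambda2Mk K ⁅x, y⁆ w + lambda2Mk K ⁅w, x⁆ y)) :
      Wspace K A k) ∈ N := by
  have hT : T0Mk K 1 a b = 0 := by
    simp only [T0Mk, mul_one, one_mul, lambda2Mk_swap K b a]
    abel
  have h := hN 1 a b x y w
  rw [ddComponents_eq, hT, add_comm, ← add_assoc] at h
  have h' := mem_of_add_mem h (FComponents_mem hN (1 * a * b) x y w)
  rw [← add_assoc, add_right_comm] at h'
  have h'' := mem_of_add_mem h' (cyclic_correction_mem (tmul_kActS2_mem hN) _ _ x y w)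
  simpa [iaMk_comm K b a, iaMk_one, TensorProduct.tmul_add] using h''

lemma iaMk_tmul_mem (a b : A) (x y w : k) :
    ((0, 0, iaMk K a b ⊗ₜ[K] lambda2Mk K ⁅x, y⁆ w) : Wspace K A k) ∈ N := by
  rw [← N.smul_mem_iff (two_ne_zero (α := K))]
  refine mem_of_add_mem ?_ (ia_tmul_add_mem hN a b w x y)
  convert add_mem (ia_tmul_add_mem hN a b x y w) (ia_tmul_add_mem hN a b y w x) using 1
  simp only [two_smul, Prod.mk_add_mk, add_zero, TensorProduct.tmul_add]
  congr 2
  abel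

lemma ia_tmul_kWedgeDer_mem (c : ia K A) (s : lambda2 K k)
    (hs : (s : k ⊗[K] k) ∈ kWedgeDer K k) : ((0, 0, c ⊗ₜ[K] s) : Wspace K A k) ∈ N := by
  have hS : {t | ∃ a b : A, t = vee K A a b - vee K A (a * b) 1} ⊆
      (ia K A : Set (A ⊗[K] A)) := by
    rintro _ ⟨a, b, rfl⟩
    exact ia_el_mem K a b
  have hT : {t | ∃ x y w : k, t = wedge K k ⁅x, y⁆ w} ⊆ (lambda2 K k : Set (k ⊗[K] k)) := by
    rintro _ ⟨x, y, w, rfl⟩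
    exact wedge_mem K _ _
  refine bilin_mem_of_mem_span hS hT
    ((TensorProduct.mk K (ia K A) (lambda2 K k)).compr₂
      (LinearMap.inr K (M1 K A k) (M2 K A k × M3 K A k) ∘ₗ LinearMap.inr K (M2 K A k) (M3 K A k)))
    ?_ (ia_le_span K A c.2) (kWedgeDer_le_span K k hs)
  rintro _ ⟨a, b, rfl⟩ _ ⟨x, y, w, rfl⟩
  exact iaMk_tmul_mem hN a b x y w

lemma T0Mk_tmul_mem (a b c : A) (x y w : k) :
    ((T0Mk K a b c ⊗ₜ[K] sym2Mk K ⁅x, y⁆ w, 0, 0) : Wspace K A k) ∈ N := by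
  have h := hN a b c x y w
  rw [ddComponents_eq] at h
  refine mem_of_add_mem (mem_of_add_mem (mem_of_add_mem ?_
    (cyclic_correction_mem (tmul_kActS2_mem hN)
      (lambda2Mk K (b * c) a) (lambda2Mk K (c * a) b) x y w))
    (FComponents_mem hN (a * b * c) x y w))
    (add_mem (add_mem (iaMk_tmul_mem hN (a * b) c x y w) (iaMk_tmul_mem hN (b * c) a y w x))
      (iaMk_tmul_mem hN (c * a) b w x y))
  convert h using 1
  simp only [FComponents, Prod.mk_add_mk, add_zero, zero_add]
  congr 1
  abel

lemma T0A_tmul_kVeeDer_mem (ω : lambda2 K A) (s : sym2 K k)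
    (hω : (ω : A ⊗[K] A) ∈ T0A K A) (hs : (s : k ⊗[K] k) ∈ kVeeDer K k) :
    ((ω ⊗ₜ[K] s, 0, 0) : Wspace K A k) ∈ N := by
  have hS : {t | ∃ a b c : A, t = wedge K A (a*b) c + wedge K A (b*c) a + wedge K A (c*a) b
      - wedge K A (a*b*c) 1} ⊆ (lambda2 K A : Set (A ⊗[K] A)) := by
    rintro _ ⟨a, b, c, rfl⟩
    exact T0A_el_mem_lambda2 K a b c
  have hT : {t | ∃ x y w : k, t = vee K k ⁅x, y⁆ w} ⊆ (sym2 K k : Set (k ⊗[K] k)) := by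
    rintro _ ⟨x, y, w, rfl⟩
    exact vee_mem K _ _
  refine bilin_mem_of_mem_span hS hT
    ((TensorProduct.mk K (lambda2 K A) (sym2 K k)).compr₂
      (LinearMap.inl K (M1 K A k) (M2 K A k × M3 K A k))) ?_ hω (kVeeDer_le_span K k hs)
  rintro _ ⟨a, b, c, rfl⟩ _ ⟨x, y, w, rfl⟩
  exact T0Mk_tmul_mem hN a b c x y w

end Boundaries

end Generators

/-- Under the identification via `P`,
`B₂(g) = Λ²(A) ⊗ k.S²(k) + T₀(A) ⊗ (k ∨ k') + im(F) + I_A ⊗ (k ∧ k')`. -/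
theorem statement6
    (P : ↥(lambda2 K (A ⊗[K] k)) ≃ₗ[K] Wspace K A k) (hP : IsDecomposition K P) :
    Submodule.map P.toLinearMap
        ((B2 K (A ⊗[K] k)).comap (lambda2 K (A ⊗[K] k)).subtype) =
      (sub1a K A k).prod ((⊥ : Submodule K (M2 K A k)).prod (⊥ : Submodule K (M3 K A k))) ⊔
      (sub1b K A k).prod ((⊥ : Submodule K (M2 K A k)).prod (⊥ : Submodule K (M3 K A k))) ⊔
      imF K A k ⊔
      (⊥ : Submodule K (M1 K A k)).prod ((⊥ : Submodule K (M2 K A k)).prod (sub3 K A k)) := by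
  refine le_antisymm ?_ ?_
  · rw [Submodule.map_le_iff_le_comap]
    set R : Submodule K (Wspace K A k) := _ ⊔ _ ⊔ _ ⊔ _ with hR
    have hpure : ∀ (a b c : A) (x y w : k),
        ddMk K (a ⊗ₜ[K] x) (b ⊗ₜ[K] y) (c ⊗ₜ[K] w) ∈ R.comap P.toLinearMap := by
      intro a b c x y w
      rw [Submodule.mem_comap, LinearEquiv.coe_coe, decomposition_ddMk K hP]
      refine ddComponents_mem ?_ ?_ ?_ ?_ a b c x y w
      · intro ω s hs
        exact Submodule.mem_sup_left (Submodule.mem_sup_left (Submodule.mem_sup_left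
          ⟨Submodule.subset_span ⟨ω, s, hs, rfl⟩, rfl, rfl⟩))
      · intro a b c x y w
        exact Submodule.mem_sup_left (Submodule.mem_sup_left (Submodule.mem_sup_right
          ⟨Submodule.subset_span ⟨_, _, T0Mk_mem K a b c, vee_lie_mem_kVeeDer K x y w, rfl⟩,
            rfl, rfl⟩))
      · intro a x y w
        exact Submodule.mem_sup_left (Submodule.mem_sup_right
          (Submodule.subset_span ⟨a, x, y, w, rfl⟩))
      · intro a b x y w
        exact Submodule.mem_sup_right
          ⟨rfl, rfl, Submodule.subset_span ⟨_, _, wedge_lie_mem_kWedgeDer K x y w, rfl⟩⟩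
    have hle : B2 K (A ⊗[K] k) ≤ (R.comap P.toLinearMap).map (lambda2 K (A ⊗[K] k)).subtype := by
      refine Submodule.span_le.2 ?_
      rintro _ ⟨u, v, w, rfl⟩
      exact ⟨ddMk K u v w, ddMk_mem K hpure u v w, rfl⟩
    intro t ht
    obtain ⟨t', ht', e⟩ := hle ht
    obtain rfl : t' = t := Subtype.ext e
    exact ht'
  · have hN : ∀ (a b c : A) (x y w : k), ddComponents K a b c x y w ∈
        ((B2 K (A ⊗[K] k)).comap (lambda2 K (A ⊗[K] k)).subtype).map P.toLinearMap := by
      intro a b c x y w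
      rw [← decomposition_ddMk K hP]
      exact Submodule.mem_map_of_mem (dd_mem_B2 K _ _ _)
    generalize ((B2 K (A ⊗[K] k)).comap (lambda2 K (A ⊗[K] k)).subtype).map P.toLinearMap = N
      at hN ⊢
    refine sup_le (sup_le (sup_le ?_ ?_) ?_) ?_
    · rintro ⟨t, _, _⟩ ⟨ht, rfl, rfl⟩
      have hle : sub1a K A k ≤ N.comap (LinearMap.inl K (M1 K A k) (M2 K A k × M3 K A k)) := by
        refine Submodule.span_le.2 ?_
        rintro _ ⟨ω, s, hs, rfl⟩
        exact tmul_kActS2_mem hN ω s hs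
      exact hle ht
    · rintro ⟨t, _, _⟩ ⟨ht, rfl, rfl⟩
      have hle : sub1b K A k ≤ N.comap (LinearMap.inl K (M1 K A k) (M2 K A k × M3 K A k)) := by
        refine Submodule.span_le.2 ?_
        rintro _ ⟨ω, s, hω, hs, rfl⟩
        exact T0A_tmul_kVeeDer_mem hN ω s hω hs
      exact hle ht
    · refine Submodule.span_le.2 ?_
      rintro _ ⟨a, x, y, w, rfl⟩
      exact FComponents_mem hN a x y w
    · rintro ⟨_, _, t⟩ ⟨rfl, rfl, ht⟩
      have hle : sub3 K A k ≤ N.comap (LinearMap.inr K (M1 K A k) (M2 K A k × M3 K A k) ∘ₗ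
          LinearMap.inr K (M2 K A k) (M3 K A k)) := by
        refine Submodule.span_le.2 ?_
        rintro _ ⟨c, s, hs, rfl⟩
        exact ia_tmul_kWedgeDer_mem hN c s hs
      exact hle ht

end CurrentPaper
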